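/- For every connected graph G, |b_g(G) − b_g'(G)| ≤ 1, i.e. the Burner-start and Staller-start game burning numbers differ by at most one. -/

import Mathlib

namespace BurningGame

/-- One spreading phase: all neighbors of burned vertices become burned. -/
noncomputable def spread {V : Type*} [Fintype V] [DecidableEq V] (G : SimpleGraph V) (B : Finset V) : Finset V :=
  ((↑B : Set V) ∪ {v | ∃ u ∈ B, G.Adj u v}).toFinite.toFinset

/-- `EndBy G turn i B k`: starting from burned set `B` at round index `i`
(the player selecting in round `i` is Burner iff `turn i = true`; Burner's selections are
quantified existentially, Staller's universally), Burner can force the game to end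
within `k` further rounds. -/
def EndBy {V : Type*} [Fintype V] [DecidableEq V] (G : SimpleGraph V) (turn : ℕ → Bool) :
    ℕ → Finset V → ℕ → Prop
  | _, B, 0 => B = Finset.univ
  | i, B, k + 1 => B = Finset.univ ∨
      spread G B = Finset.univ ∨
      (if turn i then ∃ v ∉ spread G B, EndBy G turn (i + 1) (insert v (spread G B)) k
       else ∀ v ∉ spread G B, EndBy G turn (i + 1) (insert v (spread G B)) k)

/-- Game burning number relative to a preburned set `S` (Burner starts). -/
noncomputable def bgRel {V : Type*} [Fintype V] [DecidableEq V] (G : SimpleGraph V) (S : Finset V) : ℕ :=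
  sInf {k | EndBy G (fun i => i % 2 == 0) 0 S k}

/-- The game burning number (Burner starts). -/
noncomputable def bg {V : Type*} [Fintype V] [DecidableEq V] (G : SimpleGraph V) : ℕ := bgRel G ∅

/-- The Staller-start game burning number. -/
noncomputable def bg' {V : Type*} [Fintype V] [DecidableEq V] (G : SimpleGraph V) : ℕ :=
  sInf {k | EndBy G (fun i => i % 2 == 1) 0 ∅ k}

/-- The burning number: only Burner plays. -/
noncomputable def burn {V : Type*} [Fintype V] [DecidableEq V] (G : SimpleGraph V) : ℕ :=
  sInf {k | EndBy G (fun _ => true) 0 ∅ k}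

/-- The cooling number: only Staller plays. -/
noncomputable def cool {V : Type*} [Fintype V] [DecidableEq V] (G : SimpleGraph V) : ℕ :=
  sInf {k | EndBy G (fun _ => false) 0 ∅ k}


theorem mem_spread {V : Type*} [Fintype V] [DecidableEq V] {G : SimpleGraph V}
    {B : Finset V} {v : V} : v ∈ spread G B ↔ v ∈ B ∨ ∃ u ∈ B, G.Adj u v := by
  simp [spread]

theorem subset_spread {V : Type*} [Fintype V] [DecidableEq V] (G : SimpleGraph V)
    (B : Finset V) : B ⊆ spread G B :=
  fun _ hv => mem_spread.2 (Or.inl hv)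

theorem spread_mono {V : Type*} [Fintype V] [DecidableEq V] (G : SimpleGraph V)
    {B C : Finset V} (h : B ⊆ C) : spread G B ⊆ spread G C := by
  intro v hv
  rcases mem_spread.1 hv with hv | ⟨u, hu, huv⟩
  · exact mem_spread.2 (Or.inl (h hv))
  · exact mem_spread.2 (Or.inr ⟨u, h hu, huv⟩)

/-- Continuation principle: burning more vertices in advance never hurts Burner. -/
theorem EndBy.mono {V : Type*} [Fintype V] [DecidableEq V] {G : SimpleGraph V}
    {turn : ℕ → Bool} {i k : ℕ} {B C : Finset V} (hBC : B ⊆ C)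
    (h : EndBy G turn i B k) : EndBy G turn i C k := by
  induction k generalizing i B C with
  | zero =>
    simp only [EndBy] at h ⊢
    exact Finset.univ_subset_iff.1 (h ▸ hBC)
  | succ k ih =>
    have hs := spread_mono G hBC
    rw [EndBy] at h ⊢
    rcases h with h | h | h
    · exact Or.inl (Finset.univ_subset_iff.1 (h ▸ hBC))
    · exact Or.inr (Or.inl (Finset.univ_subset_iff.1 (h ▸ hs)))
    · by_cases hC : spread G C = Finset.univ
      · exact Or.inr (Or.inl hC)
      · refine Or.inr (Or.inr ?_)
        split_ifs at h ⊢
        · obtain ⟨v, -, hv⟩ := h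
          by_cases hvC : v ∈ spread G C
          · obtain ⟨w, hw⟩ : ∃ w, w ∉ spread G C := by
              simpa [Finset.eq_univ_iff_forall] using hC
            exact ⟨w, hw, ih (Finset.insert_subset (Finset.mem_insert_of_mem hvC)
              (hs.trans (Finset.subset_insert _ _))) hv⟩
          · exact ⟨v, hvC, ih (Finset.insert_subset_insert _ hs) hv⟩
        · exact fun v hv => ih (Finset.insert_subset_insert _ hs) (h v fun hvB => hv (hs hvB))

theorem endBy_succ_index {V : Type*} [Fintype V] [DecidableEq V] (G : SimpleGraph V)
    (turn : ℕ → Bool) (i : ℕ) (B : Finset V) (k : ℕ) :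
    EndBy G turn (i + 1) B k ↔ EndBy G (fun j => turn (j + 1)) i B k := by
  induction k generalizing i B with
  | zero => simp only [EndBy]
  | succ k ih => simp only [EndBy, ih]

/-- Prepending a round, played by either player, prolongs the game by at most one round. -/
theorem EndBy.succ_of_succ_index {V : Type*} [Fintype V] [DecidableEq V] {G : SimpleGraph V}
    {turn : ℕ → Bool} {i k : ℕ} {B : Finset V} (h : EndBy G turn (i + 1) B k) :
    EndBy G turn i B (k + 1) := by
  have hsub (v : V) : B ⊆ insert v (spread G B) :=
    (subset_spread G B).trans (Finset.subset_insert _ _)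
  rw [EndBy]
  by_cases hB : spread G B = Finset.univ
  · exact Or.inr (Or.inl hB)
  · refine Or.inr (Or.inr ?_)
    split_ifs
    · obtain ⟨w, hw⟩ : ∃ w, w ∉ spread G B := by
        simpa [Finset.eq_univ_iff_forall] using hB
      exact ⟨w, hw, h.mono (hsub w)⟩
    · exact fun v _ => h.mono (hsub v)

theorem endBy_even_succ_of_odd {V : Type*} [Fintype V] [DecidableEq V] {G : SimpleGraph V}
    {B : Finset V} {k : ℕ} (h : EndBy G (fun i => i % 2 == 1) 0 B k) :
    EndBy G (fun i => i % 2 == 0) 0 B (k + 1) := by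
  refine EndBy.succ_of_succ_index ((endBy_succ_index ..).2 ?_)
  convert h using 2 with j
  grind

theorem endBy_odd_succ_of_even {V : Type*} [Fintype V] [DecidableEq V] {G : SimpleGraph V}
    {B : Finset V} {k : ℕ} (h : EndBy G (fun i => i % 2 == 0) 0 B k) :
    EndBy G (fun i => i % 2 == 1) 0 B (k + 1) := by
  refine EndBy.succ_of_succ_index ((endBy_succ_index ..).2 ?_)
  convert h using 2 with j
  grind

theorem sInf_le_sInf_add_one {S T : Set ℕ} (hST : ∀ k ∈ S, k + 1 ∈ T)
    (hTS : ∀ k ∈ T, k + 1 ∈ S) : sInf T ≤ sInf S + 1 := by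
  rcases S.eq_empty_or_nonempty with rfl | hS
  · have hT : T = ∅ := Set.eq_empty_of_forall_notMem fun k hk => hTS k hk
    simp [hT]
  · exact Nat.sInf_le (hST _ (Nat.sInf_mem hS))

theorem stmt4 {V : Type*} [Fintype V] [DecidableEq V] (G : SimpleGraph V)
    (hG : G.Connected) :
    |(bg G : ℤ) - (bg' G : ℤ)| ≤ 1 := by
  have h₁ : bg G ≤ bg' G + 1 :=
    sInf_le_sInf_add_one (fun _ => endBy_even_succ_of_odd) (fun _ => endBy_odd_succ_of_even)
  have h₂ : bg' G ≤ bg G + 1 :=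
    sInf_le_sInf_add_one (fun _ => endBy_odd_succ_of_even) (fun _ => endBy_even_succ_of_odd)
  rw [abs_le]
  omega

end BurningGame
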